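/- Let T be a tree of order at least 3. The following conditions are equivalent: (i) T is a strong unique independence graph; (ii) T is α⁻-stable and all pendant vertices of T belong to one color class C of the (unique) bipartition of T whose cardinality is at least that of the other color class; (iii) the distance between any two pendant vertices of T is even. -/

import Mathlib

open Finset

variable {V : Type*}

/-- A stable (independent) set of vertices of `G`. -/
def IsStableSet (G : SimpleGraph V) (S : Finset V) : Prop :=
  ∀ u ∈ S, ∀ v ∈ S, ¬ G.Adj u v

/-- The stability number `α(G)`: the maximum cardinality of a stable set. -/
noncomputable def stabNum (G : SimpleGraph V) [Fintype V] : ℕ :=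
  sSup {n : ℕ | ∃ S : Finset V, IsStableSet G S ∧ S.card = n}

/-- A stability system of `G`: a stable set of maximum cardinality. -/
def IsStabSystem (G : SimpleGraph V) [Fintype V] (S : Finset V) : Prop :=
  IsStableSet G S ∧ S.card = stabNum G

/-- `G` is α⁻-stable: deleting any edge leaves the stability number unchanged. -/
def AlphaMinusStable (G : SimpleGraph V) [Fintype V] : Prop :=
  ∀ u v : V, G.Adj u v → stabNum (G.deleteEdges {s(u, v)}) = stabNum G

/-- `G` is α⁺-stable: adding any edge of the complement leaves the stability
number unchanged. -/
def AlphaPlusStable (G : SimpleGraph V) [Fintype V] : Prop :=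
  ∀ u v : V, u ≠ v → ¬ G.Adj u v →
    stabNum (G ⊔ SimpleGraph.fromEdgeSet {s(u, v)}) = stabNum G

/-- A matching of `G`, viewed as a set of pairwise non-incident edges. -/
def IsMatchingSet (G : SimpleGraph V) (M : Finset (Sym2 V)) : Prop :=
  (↑M : Set (Sym2 V)) ⊆ G.edgeSet ∧
    ∀ e ∈ M, ∀ f ∈ M, e ≠ f → ∀ v : V, ¬ (v ∈ e ∧ v ∈ f)

/-- The matching number `μ(G)`. -/
noncomputable def matchNum (G : SimpleGraph V) [Fintype V] : ℕ :=
  sSup {n : ℕ | ∃ M : Finset (Sym2 V), IsMatchingSet G M ∧ M.card = n}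

/-- A maximum matching of `G`. -/
def IsMaximumMatching (G : SimpleGraph V) [Fintype V] (M : Finset (Sym2 V)) : Prop :=
  IsMatchingSet G M ∧ M.card = matchNum G

/-- A perfect matching of `G`: a matching covering every vertex. -/
def IsPerfectMatchingSet (G : SimpleGraph V) (M : Finset (Sym2 V)) : Prop :=
  IsMatchingSet G M ∧ ∀ v : V, ∃ e ∈ M, v ∈ e

/-- A pendant vertex: a vertex of degree one. -/
def IsPendant (G : SimpleGraph V) (v : V) : Prop :=
  (G.neighborSet v).ncard = 1

/-- A set `D` is 2-dominating: every vertex outside `D` has at least two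
neighbors in `D`. -/
def Is2Dominating (G : SimpleGraph V) (D : Finset V) : Prop :=
  ∀ v : V, v ∉ D → 2 ≤ ({u : V | u ∈ D ∧ G.Adj v u}).ncard

/-- A chordal graph: no induced cycle on four or more vertices. -/
def IsChordal (G : SimpleGraph V) : Prop :=
  ∀ n : ℕ, 4 ≤ n → IsEmpty (SimpleGraph.cycleGraph n ↪g G)

/-- A bipartite graph: the vertex set is partitioned into two stable sets. -/
def IsBipartiteGr (G : SimpleGraph V) [Fintype V] [DecidableEq V] : Prop :=
  ∃ C : Finset V, IsStableSet G C ∧ IsStableSet G Cᶜ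

/-- A strong unique independence graph: a graph with a unique stability system
whose complement is also stable. -/
def IsStrongUniqueIndep (G : SimpleGraph V) [Fintype V] [DecidableEq V] : Prop :=
  ∃ S : Finset V, IsStabSystem G S ∧ (∀ S' : Finset V, IsStabSystem G S' → S' = S) ∧
    IsStableSet G Sᶜ

/-- A bistable bipartite graph: its two color classes are its only two
stability systems. -/
def IsBistable (G : SimpleGraph V) [Fintype V] [DecidableEq V] : Prop :=
  ∃ A : Finset V, IsStableSet G A ∧ IsStableSet G Aᶜ ∧
    IsStabSystem G A ∧ IsStabSystem G Aᶜ ∧ A ≠ Aᶜ ∧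
    ∀ S : Finset V, IsStabSystem G S → S = A ∨ S = Aᶜ

/-- A vertex cover of `G`. -/
def IsVertexCover (G : SimpleGraph V) (C : Finset V) : Prop :=
  ∀ u v : V, G.Adj u v → u ∈ C ∨ v ∈ C

/-- A minimum vertex cover of `G`. -/
def IsMinVertexCover (G : SimpleGraph V) [Fintype V] (C : Finset V) : Prop :=
  IsVertexCover G C ∧ ∀ C' : Finset V, IsVertexCover G C' → C.card ≤ C'.card

theorem IsStableSet.mono {G : SimpleGraph V} {S S' : Finset V} (h : IsStableSet G S)
    (hsub : S' ⊆ S) : IsStableSet G S' :=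
  fun u hu v hv => h u (hsub hu) v (hsub hv)

theorem bddAbove_card_isStableSet (G : SimpleGraph V) [Fintype V] :
    BddAbove {n : ℕ | ∃ S : Finset V, IsStableSet G S ∧ S.card = n} :=
  ⟨Fintype.card V, by rintro _ ⟨S, -, rfl⟩; exact S.card_le_univ⟩

theorem IsStableSet.card_le_stabNum {G : SimpleGraph V} [Fintype V] {S : Finset V}
    (h : IsStableSet G S) : S.card ≤ stabNum G :=
  le_csSup (bddAbove_card_isStableSet G) ⟨S, h, rfl⟩

theorem exists_isStabSystem (G : SimpleGraph V) [Fintype V] : ∃ S, IsStabSystem G S :=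
  Nat.sSup_mem (s := {n : ℕ | ∃ S : Finset V, IsStableSet G S ∧ S.card = n})
    ⟨0, ∅, by simp [IsStableSet], rfl⟩ (bddAbove_card_isStableSet G)

theorem IsStableSet.isStabSystem_of_le {G : SimpleGraph V} [Fintype V] {S : Finset V}
    (h : IsStableSet G S) (hle : stabNum G ≤ S.card) : IsStabSystem G S :=
  ⟨h, h.card_le_stabNum.antisymm hle⟩

theorem stabNum_anti {G H : SimpleGraph V} [Fintype V] (hle : H ≤ G) :
    stabNum G ≤ stabNum H := by
  obtain ⟨S, hS, hcard⟩ := exists_isStabSystem G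
  have hS' : IsStableSet H S := fun u hu v hv huv => hS u hu v hv (hle huv)
  exact hcard ▸ hS'.card_le_stabNum

/-- Two adjacent vertices cannot both lie in the unique stability system, so a larger stable set
obtained by deleting an edge would yield two distinct stability systems. -/
theorem alphaMinusStable_of_unique [Fintype V] [DecidableEq V] {G : SimpleGraph V} {S : Finset V}
    (huniq : ∀ S', IsStabSystem G S' → S' = S) : AlphaMinusStable G := by
  intro u v huv
  refine le_antisymm ?_ (stabNum_anti (G.deleteEdges_le _))
  by_contra! hlt
  obtain ⟨S', hS', hcard⟩ := exists_isStabSystem (G.deleteEdges {s(u, v)})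
  have hne := huv.ne
  have hadj : ∀ a ∈ S', ∀ b ∈ S', G.Adj a b → s(a, b) = s(u, v) := by
    intro a ha b hb hab
    have h := hS' a ha b hb
    simp only [SimpleGraph.deleteEdges_adj, Set.mem_singleton_iff] at h
    tauto
  have hu : u ∈ S' ∧ v ∈ S' := by
    by_contra h
    have hst : IsStableSet G S' := by
      intro a ha b hb hab
      rcases Sym2.eq_iff.mp (hadj a ha b hb hab) with ⟨rfl, rfl⟩ | ⟨rfl, rfl⟩ <;> tauto
    have := hst.card_le_stabNum
    omega
  have key : ∀ w, (w = u ∨ w = v) → IsStabSystem G (S'.erase w) := by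
    intro w hw
    have hwS : w ∈ S' := by rcases hw with rfl | rfl <;> tauto
    refine IsStableSet.isStabSystem_of_le ?_ (by rw [card_erase_of_mem hwS]; omega)
    intro a ha b hb hab
    rw [mem_erase] at ha hb
    rcases Sym2.eq_iff.mp (hadj a ha.2 b hb.2 hab) with ⟨rfl, rfl⟩ | ⟨rfl, rfl⟩ <;> tauto
  have heq := (huniq _ (key u (.inl rfl))).trans (huniq _ (key v (.inr rfl))).symm
  have : v ∈ S'.erase v := heq ▸ mem_erase.mpr ⟨hne.symm, hu.2⟩
  simp at this

theorem IsPendant.mem_of_unique [Fintype V] [DecidableEq V] {G : SimpleGraph V} {S : Finset V}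
    (hS : IsStabSystem G S) (huniq : ∀ S', IsStabSystem G S' → S' = S)
    (hSc : IsStableSet G Sᶜ) {v : V} (hv : IsPendant G v) : v ∈ S := by
  by_contra hvS
  obtain ⟨u, hu⟩ := Set.ncard_eq_one.mp hv
  have hadj : ∀ w, G.Adj v w ↔ w = u := fun w => by
    rw [← SimpleGraph.mem_neighborSet, hu, Set.mem_singleton_iff]
  have huS : u ∈ S := by
    by_contra huS
    exact hSc v (mem_compl.mpr hvS) u (mem_compl.mpr huS) ((hadj u).mpr rfl)
  have hst : IsStableSet G (insert v (S.erase u)) := by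
    intro a ha b hb hab
    rw [mem_insert, mem_erase] at ha hb
    rcases ha with rfl | ha
    · have := (hadj b).mp hab
      rcases hb with rfl | hb
      · exact hab.ne rfl
      · exact hb.1 this
    · rcases hb with rfl | hb
      · exact ha.1 ((hadj a).mp hab.symm)
      · exact hS.1 a ha.2 b hb.2 hab
  have hcard : (insert v (S.erase u)).card = S.card := by
    rw [card_insert_of_notMem (by simp [hvS]), card_erase_add_one huS]
  have := huniq _ ⟨hst, hcard.trans hS.2⟩
  exact hvS (this ▸ mem_insert_self _ _)

/-- Along a walk, membership in a color class of a bipartition changes at every step. -/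
theorem even_length_iff_of_bipartition [Fintype V] [DecidableEq V] {G : SimpleGraph V}
    {C : Finset V} (hC : IsStableSet G C) (hCc : IsStableSet G Cᶜ) {u v : V} (p : G.Walk u v) :
    Even p.length ↔ (u ∈ C ↔ v ∈ C) := by
  induction p with
  | nil => simp
  | @cons a b c h p ih =>
    have h1 := fun ha hb => hC a ha b hb h
    have h2 := fun ha hb => hCc a ha b hb h
    simp only [mem_compl] at h2
    rw [SimpleGraph.Walk.length_cons, Nat.even_add_one, ih]
    tauto

theorem even_dist_iff_of_bipartition [Fintype V] [DecidableEq V] {G : SimpleGraph V}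
    (hG : G.Connected) {C : Finset V} (hC : IsStableSet G C) (hCc : IsStableSet G Cᶜ) (u v : V) :
    Even (G.dist u v) ↔ (u ∈ C ↔ v ∈ C) := by
  obtain ⟨p, hp⟩ := hG.exists_walk_length_eq_dist u v
  rw [← hp, even_length_iff_of_bipartition hC hCc]

/-- In a tree, a vertex has at most one neighbor closer to a given root. -/
theorem SimpleGraph.IsTree.eq_of_adj_of_dist_add_one_eq {T : SimpleGraph V} (hT : T.IsTree)
    {r x x' y : V} (hx : T.Adj x y) (hx' : T.Adj x' y) (hd : T.dist r x + 1 = T.dist r y)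
    (hd' : T.dist r x' + 1 = T.dist r y) : x = x' := by
  have key : ∀ z, T.Adj z y → T.dist r z + 1 = T.dist r y →
      ∃ p : T.Walk r y, p.IsPath ∧ p.penultimate = z := by
    intro z hz hzd
    obtain ⟨p, hp⟩ := hT.connected.exists_walk_length_eq_dist r z
    refine ⟨p.concat hz, SimpleGraph.Walk.isPath_of_length_eq_dist _ ?_, by simp⟩
    rw [SimpleGraph.Walk.length_concat, hp, hzd]
  obtain ⟨p, hp, rfl⟩ := key x hx hd
  obtain ⟨q, hq, rfl⟩ := key x' hx' hd'
  rw [(hT.existsUnique_path r y).unique hp hq]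

/-- A strict Hall condition: in a tree, a nonempty set of vertices of degree at least two has
strictly fewer elements than its neighborhood. -/
theorem SimpleGraph.IsTree.card_lt_card_of_neighbors_mem [DecidableEq V] {T : SimpleGraph V}
    (hT : T.IsTree) {X Y : Finset V} (hX : X.Nonempty)
    (hdeg : ∀ x ∈ X, ∃ a b, a ≠ b ∧ T.Adj x a ∧ T.Adj x b)
    (hY : ∀ x ∈ X, ∀ y, T.Adj x y → y ∈ Y) : X.card < Y.card := by
  obtain ⟨r, hr⟩ := hX
  have hchild : ∀ x : V, ∃ y, x ∈ X → T.Adj x y ∧ T.dist r x + 1 = T.dist r y := by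
    intro x
    by_cases hx : x ∈ X
    · obtain ⟨a, b, hab, ha, hb⟩ := hdeg x hx
      rcases hT.dist_eq_dist_add_one_of_adj r ha with h | h
      · rcases hT.dist_eq_dist_add_one_of_adj r hb with h' | h'
        · exact absurd (hT.eq_of_adj_of_dist_add_one_eq ha.symm hb.symm h.symm h'.symm) hab
        · exact ⟨b, fun _ => ⟨hb, h'.symm⟩⟩
      · exact ⟨a, fun _ => ⟨ha, h.symm⟩⟩
    · exact ⟨x, fun h => absurd h hx⟩
  choose f hf using hchild
  have hinj : Set.InjOn f X := fun x hx x' hx' h =>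
    hT.eq_of_adj_of_dist_add_one_eq (hf x hx).1 (h ▸ (hf x' hx').1) (hf x hx).2
      (h ▸ (hf x' hx').2)
  obtain ⟨c, hc, hcf⟩ : ∃ c, T.Adj r c ∧ c ≠ f r := by
    obtain ⟨a, b, hab, ha, hb⟩ := hdeg r hr
    by_cases h : a = f r
    · exact ⟨b, hb, fun h' => hab (h.trans h'.symm)⟩
    · exact ⟨a, ha, h⟩
  rw [← card_image_of_injOn hinj]
  refine card_lt_card ((ssubset_iff_of_subset ?_).mpr ⟨c, hY r hr c hc, ?_⟩)
  · exact image_subset_iff.mpr fun x hx => hY x hx _ (hf x hx).1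
  · intro hmem
    obtain ⟨x, hx, rfl⟩ := mem_image.mp hmem
    have hrd : T.dist r r + 1 = T.dist r (f x) := by
      rw [SimpleGraph.dist_self, SimpleGraph.dist_eq_one_iff_adj.mpr hc]
    have := hT.eq_of_adj_of_dist_add_one_eq hc (hf x hx).1 hrd (hf x hx).2
    exact hcf (this ▸ rfl)

theorem SimpleGraph.IsTree.exists_two_neighbors_of_not_isPendant [Finite V] [Nontrivial V]
    {T : SimpleGraph V} (hT : T.IsTree) {v : V} (hv : ¬ IsPendant T v) :
    ∃ a b, a ≠ b ∧ T.Adj v a ∧ T.Adj v b := by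
  obtain ⟨a, ha⟩ := hT.connected.preconnected.exists_adj_of_nontrivial v
  by_contra! h
  refine hv (Set.ncard_eq_one.mpr ⟨a, Set.ext fun b => ⟨fun hb => ?_, fun hb => hb ▸ ha⟩⟩)
  by_contra hab
  exact h a b (Ne.symm hab) ha hb

/-- If no vertex outside a color class of a tree is pendant, then that class is the unique
stability system. -/
theorem SimpleGraph.IsTree.isStrongUniqueIndep_of_pendant_mem [Fintype V] [DecidableEq V]
    [Nontrivial V] {T : SimpleGraph V} (hT : T.IsTree) {C : Finset V} (hC : IsStableSet T C)
    (hCc : IsStableSet T Cᶜ) (hpend : ∀ v, IsPendant T v → v ∈ C) : IsStrongUniqueIndep T := by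
  have hlt : ∀ S, IsStableSet T S → (S \ C).Nonempty → S.card < C.card := by
    intro S hS hne
    have := hT.card_lt_card_of_neighbors_mem (Y := C \ S) hne
      (fun x hx => hT.exists_two_neighbors_of_not_isPendant
        fun hp => (mem_sdiff.mp hx).2 (hpend x hp))
      (fun x hx y hxy => by
        rw [mem_sdiff] at hx ⊢
        refine ⟨?_, fun hy => hS x hx.1 y hy hxy⟩
        by_contra hy
        exact hCc x (mem_compl.mpr hx.2) y (mem_compl.mpr hy) hxy)
    have h1 := card_sdiff_add_card_inter S C
    have h2 := card_sdiff_add_card_inter C S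
    rw [inter_comm] at h2
    omega
  have hsys : IsStabSystem T C := by
    obtain ⟨S, hS, hcard⟩ := exists_isStabSystem T
    refine hC.isStabSystem_of_le (hcard ▸ ?_)
    rcases (S \ C).eq_empty_or_nonempty with h | h
    · exact card_le_card (sdiff_eq_empty_iff_subset.mp h)
    · exact (hlt S hS h).le
  refine ⟨C, hsys, fun S hS => ?_, hCc⟩
  have hcard : S.card = C.card := hS.2.trans hsys.2.symm
  rcases (S \ C).eq_empty_or_nonempty with h | h
  · exact eq_of_subset_of_card_le (sdiff_eq_empty_iff_subset.mp h) hcard.ge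
  · exact absurd hcard (hlt S hS.1 h).ne

theorem SimpleGraph.IsTree.exists_bipartition_mem [Fintype V] [DecidableEq V]
    {T : SimpleGraph V} (hT : T.IsTree) (r : V) :
    ∃ C : Finset V, IsStableSet T C ∧ IsStableSet T Cᶜ ∧ r ∈ C := by
  classical
  refine ⟨univ.filter fun v => Even (T.dist r v), fun u hu v hv huv => ?_, fun u hu v hv huv => ?_, by simp⟩ <;>
  · simp only [mem_compl, mem_filter_univ] at hu hv
    rcases hT.dist_eq_dist_add_one_of_adj r huv with h | h <;> grind

/-- For a tree `T` of order at least 3, the following are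
equivalent: (i) `T` is a strong unique independence graph; (ii) `T` is
α⁻-stable and all its pendant vertices belong to a color class `C` of its
bipartition with `|Cᶜ| ≤ |C|`; (iii) the distance between any two pendant
vertices of `T` is even. -/
theorem stmt4 {V : Type*} [Fintype V] [DecidableEq V] (T : SimpleGraph V)
    (hT : T.IsTree) (h3 : 3 ≤ Fintype.card V) :
    List.TFAE
      [ IsStrongUniqueIndep T,
        AlphaMinusStable T ∧ ∃ C : Finset V, IsStableSet T C ∧ IsStableSet T Cᶜ ∧
          Cᶜ.card ≤ C.card ∧ ∀ v : V, IsPendant T v → v ∈ C,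
        ∀ u v : V, IsPendant T u → IsPendant T v → Even (T.dist u v) ] := by
  have : Nontrivial V := Fintype.one_lt_card_iff_nontrivial.mp (by omega)
  tfae_have 1 → 2 := by
    rintro ⟨S, hS, huniq, hSc⟩
    exact ⟨alphaMinusStable_of_unique huniq, S, hS.1, hSc, hS.2 ▸ hSc.card_le_stabNum,
      fun v hv => hv.mem_of_unique hS huniq hSc⟩
  tfae_have 2 → 3 := by
    rintro ⟨-, C, hC, hCc, -, hpend⟩ u v hu hv
    exact (even_dist_iff_of_bipartition hT.connected hC hCc u v).mpr
      (iff_of_true (hpend u hu) (hpend v hv))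
  tfae_have 3 → 1 := by
    intro h
    obtain ⟨r, hr⟩ : ∃ r, ∀ v, IsPendant T v → Even (T.dist r v) := by
      by_cases hp : ∃ r, IsPendant T r
      · obtain ⟨r, hr⟩ := hp
        exact ⟨r, fun v hv => h r v hr hv⟩
      · exact ⟨Classical.arbitrary V, fun v hv => absurd ⟨v, hv⟩ hp⟩
    obtain ⟨C, hC, hCc, hrC⟩ := hT.exists_bipartition_mem r
    exact hT.isStrongUniqueIndep_of_pendant_mem hC hCc fun v hv =>
      ((even_dist_iff_of_bipartition hT.connected hC hCc r v).mp (hr v hv)).mp hrC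
  tfae_finish
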